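/- Let N and m̂ be positive integers, let x_1, …, x_N ∈ ℝ^{m̂} with ‖x_i‖_∞ ≤ 1 for each i, let d_1, …, d_N be nonnegative reals with ∑_{i=1}^N d_i ≤ D̄ where D̄ > 0, let L > 0, let φ(x) = 1/(1 + e^{−x}), and for Θ = (θ_1, …, θ_N) with each θ_i ∈ ℝ^{m̂} define f^Θ(S) = ∑_{i∈S} d_i φ(⟨x_i, θ_i⟩) for subsets S ⊆ {1, …, N}. Then for every α > 0 there exists a finite set T of parameter tuples Θ' = (θ'_1, …, θ'_N) with ‖θ'_i‖_∞ ≤ L for all i, of cardinality at most ⌈L D̄ m̂ / (2α)⌉^{N m̂}, such that for every Θ with ‖θ_i‖_∞ ≤ L for all i there exists Θ' ∈ T with |f^Θ(S) − f^{Θ'}(S)| ≤ α for every subset S ⊆ {1, …, N}. -/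

import Mathlib

open Finset

/-- The logistic (sigmoid) function `φ(x) = 1 / (1 + e^{-x})`. -/
noncomputable def phi (x : ℝ) : ℝ := 1 / (1 + Real.exp (-x))

/-- The expected load-reduction reward of a subset `S` of customers under parameters
`Θ = (θ i)`: `f^Θ(S) = ∑ i in S, d i * φ(⟨x i, Θ i⟩)`. -/
noncomputable def reward {N mhat : ℕ} (d : Fin N → ℝ) (x : Fin N → Fin mhat → ℝ)
    (Θ : Fin N → Fin mhat → ℝ) (S : Finset (Fin N)) : ℝ :=
  ∑ i ∈ S, d i * phi (∑ j, x i j * Θ i j)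

theorem phi_hasDerivAt (x : ℝ) :
    HasDerivAt phi (Real.exp (-x) / (1 + Real.exp (-x)) ^ 2) x := by
  have hpos : (1 + Real.exp (-x)) ≠ 0 := by positivity
  have h1 : HasDerivAt (fun y : ℝ => 1 + Real.exp (-y)) (-Real.exp (-x)) x := by
    have := ((hasDerivAt_neg x).exp).const_add 1
    simpa using this
  have h2 := h1.inv hpos
  have e : phi = (fun y : ℝ => 1 + Real.exp (-y))⁻¹ := by
    funext y
    simp [phi]
  rw [e]
  simpa using h2

theorem phi_lip (a b : ℝ) : |phi a - phi b| ≤ 1 / 4 * |a - b| := by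
  have := Convex.norm_image_sub_le_of_norm_hasDerivWithin_le (f := phi)
    (f' := fun x => Real.exp (-x) / (1 + Real.exp (-x)) ^ 2) (C := 1 / 4) (s := Set.univ)
    (x := b) (y := a) (fun x _ => (phi_hasDerivAt x).hasDerivWithinAt)
    (fun x _ => by
      have hp := Real.exp_pos (-x)
      rw [Real.norm_of_nonneg (by positivity), div_le_iff₀ (by positivity)]
      nlinarith [sq_nonneg (1 - Real.exp (-x))])
    convex_univ (Set.mem_univ _) (Set.mem_univ _)
  simpa [Real.norm_eq_abs] using this

theorem grid_cover (L : ℝ) (hL : 0 < L) (K : ℕ) (hK : 0 < K) (t : ℝ) (ht : |t| ≤ L) :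
    ∃ k : Fin K, |t - (-L + 2 * L / K * (k : ℕ))| ≤ 2 * L / K := by
  have hK' : (0 : ℝ) < K := by exact_mod_cast hK
  obtain ⟨h1, h2⟩ := abs_le.1 ht
  set r : ℝ := 2 * L / K with hr
  have hrpos : 0 < r := by positivity
  have hrK : r * K = 2 * L := by rw [hr]; field_simp
  have hnn : 0 ≤ (t + L) / r := div_nonneg (by linarith) hrpos.le
  by_cases hlt : ⌊(t + L) / r⌋₊ < K
  · refine ⟨⟨_, hlt⟩, ?_⟩
    have a1 := Nat.floor_le hnn
    have a2 := Nat.lt_floor_add_one ((t + L) / r)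
    rw [le_div_iff₀ hrpos] at a1
    rw [div_lt_iff₀ hrpos] at a2
    rw [abs_le]
    constructor <;> dsimp only <;> nlinarith
  · refine ⟨⟨K - 1, by omega⟩, ?_⟩
    have a1 : (K : ℝ) ≤ (t + L) / r := (Nat.le_floor_iff hnn).1 (not_lt.1 hlt)
    rw [le_div_iff₀ hrpos] at a1
    have e : ((K - 1 : ℕ) : ℝ) = K - 1 := by
      rw [Nat.cast_sub (by omega)]; simp
    simp only [e]
    rw [abs_le]
    constructor <;> nlinarith

/-- **Sup-norm covering of the reward function class (Lemma 4, quantitative form).**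
With contexts `‖x i‖_∞ ≤ 1`, nonnegative loads `∑ d i ≤ D̄`, `D̄ > 0`, `L > 0`:
for every `α > 0` there is a finite set `T` of parameter tuples, each bounded by `L` in
max-norm, with `|T| ≤ ⌈L·D̄·m̂/(2α)⌉^{N·m̂}`, such that every bounded parameter tuple `Θ`
has some `Θ' ∈ T` with `|f^Θ(S) - f^{Θ'}(S)| ≤ α` for every subset `S`.
Here `Fin mhat → ℝ` carries the sup (max) norm, so `‖Θ i‖ = ‖θ_i‖_∞`. -/
theorem reward_class_covering
    (N mhat : ℕ) (hN : 0 < N) (hm : 0 < mhat)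
    (x : Fin N → Fin mhat → ℝ) (hx : ∀ i, ‖x i‖ ≤ 1)
    (d : Fin N → ℝ) (hd : ∀ i, 0 ≤ d i) (Dbar : ℝ) (hDbar : 0 < Dbar)
    (hsum : ∑ i, d i ≤ Dbar)
    (L α : ℝ) (hL : 0 < L) (hα : 0 < α) :
    ∃ T : Finset (Fin N → Fin mhat → ℝ),
      (∀ Θ' ∈ T, ∀ i, ‖Θ' i‖ ≤ L)
        ∧ T.card ≤ (⌈L * Dbar * mhat / (2 * α)⌉₊) ^ (N * mhat)
        ∧ ∀ Θ : Fin N → Fin mhat → ℝ, (∀ i, ‖Θ i‖ ≤ L) →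
            ∃ Θ' ∈ T, ∀ S : Finset (Fin N),
              |reward d x Θ S - reward d x Θ' S| ≤ α := by
  set K : ℕ := ⌈L * Dbar * mhat / (2 * α)⌉₊ with hKdef
  have hm' : (0 : ℝ) < mhat := by exact_mod_cast hm
  have hK : 0 < K := Nat.ceil_pos.2 (by positivity)
  have hK' : (0 : ℝ) < K := by exact_mod_cast hK
  have hKle : L * Dbar * mhat / (2 * α) ≤ K := Nat.le_ceil _
  rw [div_le_iff₀ (by positivity)] at hKle
  have hrK : 2 * L / K * K = 2 * L := by field_simp
  have hrpos : 0 < 2 * L / K := by positivity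
  classical
  refine ⟨Finset.univ.image (fun (κ : Fin N → Fin mhat → Fin K) i j =>
    -L + 2 * L / K * ((κ i j : ℕ) : ℝ)), ?_, ?_, ?_⟩
  · intro Θ' hΘ' i
    obtain ⟨κ, -, rfl⟩ := Finset.mem_image.1 hΘ'
    rw [pi_norm_le_iff_of_nonneg hL.le]
    intro j
    have h1 : ((κ i j : ℕ) : ℝ) ≤ K := by exact_mod_cast (κ i j).2.le
    have h0 : (0 : ℝ) ≤ ((κ i j : ℕ) : ℝ) := Nat.cast_nonneg _
    have h2 := mul_le_mul_of_nonneg_left h1 hrpos.le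
    have h3 := mul_nonneg hrpos.le h0
    rw [Real.norm_eq_abs, abs_le]
    constructor <;> linarith
  · refine Finset.card_image_le.trans (le_of_eq ?_)
    simp [← pow_mul, mul_comm]
  · intro Θ hΘ
    have hc : ∀ i j, ∃ k : Fin K, |Θ i j - (-L + 2 * L / K * (k : ℕ))| ≤ 2 * L / K :=
      fun i j => grid_cover L hL K hK _ ((norm_le_pi_norm (Θ i) j).trans (hΘ i))
    choose κ hκ using hc
    refine ⟨_, Finset.mem_image_of_mem _ (Finset.mem_univ κ), fun S => ?_⟩
    set Θ' : Fin N → Fin mhat → ℝ := fun i j => -L + 2 * L / K * ((κ i j : ℕ) : ℝ) with hΘ'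
    have hin : ∀ i, |(∑ j, x i j * Θ i j) - ∑ j, x i j * Θ' i j| ≤ mhat * (2 * L / K) := by
      intro i
      rw [← Finset.sum_sub_distrib]
      refine (Finset.abs_sum_le_sum_abs _ _).trans ?_
      have : ∀ j ∈ (Finset.univ : Finset (Fin mhat)),
          |x i j * Θ i j - x i j * Θ' i j| ≤ 2 * L / K := by
        intro j _
        rw [← mul_sub, abs_mul]
        have hxj : |x i j| ≤ 1 := (norm_le_pi_norm (x i) j).trans (hx i)
        calc |x i j| * |Θ i j - Θ' i j| ≤ 1 * (2 * L / K) :=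
              mul_le_mul hxj (hκ i j) (abs_nonneg _) zero_le_one
          _ = _ := one_mul _
      simpa using Finset.sum_le_card_nsmul _ _ _ this
    set c : ℝ := 1 / 4 * (mhat * (2 * L / K)) with hcdef
    have hcpos : 0 ≤ c := by positivity
    have hfin : Dbar * c ≤ α := by
      have : Dbar * c = L * Dbar * mhat / (2 * K) := by rw [hcdef]; field_simp; norm_num
      rw [this, div_le_iff₀ (by positivity)]
      linarith
    unfold reward
    rw [← Finset.sum_sub_distrib]
    calc _ ≤ ∑ i ∈ S, |d i * phi (∑ j, x i j * Θ i j) - d i * phi (∑ j, x i j * Θ' i j)| :=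
          Finset.abs_sum_le_sum_abs _ _
      _ ≤ ∑ i ∈ S, d i * c := by
          refine Finset.sum_le_sum fun i _ => ?_
          rw [← mul_sub, abs_mul, abs_of_nonneg (hd i)]
          refine mul_le_mul_of_nonneg_left ((phi_lip _ _).trans ?_) (hd i)
          exact mul_le_mul_of_nonneg_left (hin i) (by norm_num)
      _ ≤ ∑ i, d i * c :=
          Finset.sum_le_sum_of_subset_of_nonneg (Finset.subset_univ _)
            fun i _ _ => mul_nonneg (hd i) hcpos
      _ = (∑ i, d i) * c := by rw [Finset.sum_mul]
      _ ≤ Dbar * c := mul_le_mul_of_nonneg_right hsum hcpos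
      _ ≤ α := hfin
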